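/- Fix 0 < p < 1 and reals τ ≥ 0 and κ > 0 with κ > τ/p. Suppose t(n) is a sequence of nonnegative integers with t(n)/ln n → τ and k(n) is a sequence of positive integers with k(n)/ln n → κ as n → ∞. Let S_{n,t,k} be the (random) collection of t(n)-dependent k(n)-element vertex subsets of G(n,p). Then E(|S_{n,t,k}|) = exp( k(n)·ln n · (1 − (κ/2)·Λ*(τ/κ) + o(1)) ); that is, ln E(|S_{n,t,k}|) / (k(n)·ln n) → 1 − (κ/2)·Λ*(τ/κ) as n → ∞. -/

import Mathlib

open MeasureTheory Filter
open scoped ENNReal NNReal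

/-- The Bernoulli(p) measure on `Bool`. -/
noncomputable def bernoulliBool (p : ℝ) : Measure Bool :=
  p.toNNReal • Measure.dirac true + (1 - p).toNNReal • Measure.dirac false

instance (p : ℝ) : IsFiniteMeasure (bernoulliBool p) := by
  unfold bernoulliBool; infer_instance

instance (n : ℕ) : MeasurableSpace (SimpleGraph (Fin n)) := ⊤

/-- The Erdős–Rényi random graph `G(n,p)`: the distribution of the simple graph on `Fin n`
obtained by including each possible edge independently with probability `p`. -/
noncomputable def erMeasure (n : ℕ) (p : ℝ) : Measure (SimpleGraph (Fin n)) :=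
  Measure.map (fun f : Sym2 (Fin n) → Bool => SimpleGraph.fromEdgeSet {e | f e = true})
    (Measure.pi fun _ : Sym2 (Fin n) => bernoulliBool p)

/-- A set `S` of vertices is `t`-dependent if the induced subgraph has maximum degree at most `t`,
i.e. every vertex of `S` has at most `t` neighbours inside `S`. -/
def IsTDependent {V : Type*} (G : SimpleGraph V) (t : ℕ) (S : Set V) : Prop :=
  ∀ v ∈ S, {u ∈ S | G.Adj v u}.ncard ≤ t

/-- The `t`-improper chromatic number: the least number of colours in a vertex colouring
in which every colour class is `t`-dependent. -/
noncomputable def improperChromaticNumber {V : Type*} (G : SimpleGraph V) (t : ℕ) : ℕ :=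
  sInf {k | ∃ c : V → Fin k, ∀ i : Fin k, IsTDependent G t {v | c v = i}}

/-- The `t`-dependence number: the maximum size of a `t`-dependent set. -/
noncomputable def tDependenceNumber {V : Type*} (G : SimpleGraph V) (t : ℕ) : ℕ :=
  sSup {m | ∃ S : Set V, S.ncard = m ∧ IsTDependent G t S}

/-- The Fenchel–Legendre transform `Λ*(x) = x ln(x/p) + (1-x) ln((1-x)/(1-p))`
(with the conventions `Λ*(0) = ln(1/(1-p))`, `Λ*(1) = ln(1/p)`, which hold automatically
since `Real.log 0 = 0` in Lean). -/
noncomputable def LambdaStar (p x : ℝ) : ℝ :=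
  x * Real.log (x / p) + (1 - x) * Real.log ((1 - x) / (1 - p))

/-- The edges of the complete graph on `S`. -/
def innerEdges {V : Type*} [DecidableEq V] (S : Finset V) : Finset (Sym2 V) :=
  S.offDiag.image (Function.uncurry Sym2.mk)

/-- The edges of the complete graph on `S` incident to `v`. -/
def incidentEdges {V : Type*} [DecidableEq V] (S : Finset V) (v : V) : Finset (Sym2 V) :=
  {e ∈ innerEdges S | v ∈ e}

/-- The number of elements of `D` on which `f` is true. -/
def trueCount {E : Type*} (D : Finset E) (f : E → Bool) : ℕ :=
  ({e ∈ D | f e = true} : Finset E).card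

/-- The probability of the outcome `f` when `f e` is true with probability `a e`,
independently for all `e`. -/
noncomputable def bernoulliWeight {E : Type*} [Fintype E] (a : E → ℝ) (f : E → Bool) : ℝ :=
  ∏ e, if f e = true then a e else 1 - a e

/-- Every vertex of `S` is incident to at most `t` edges inside `S` on which `f` is true. -/
def DegreeLE {V : Type*} [DecidableEq V] (t : ℕ) (S : Finset V) (f : Sym2 V → Bool) : Prop :=
  ∀ v ∈ S, trueCount (incidentEdges S v) f ≤ t

lemma sym2Mk_injective {V : Type*} (v : V) : Function.Injective fun u => s(v, u) :=
  fun _ _ h => Sym2.congr_right.1 h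

lemma mk_mem_innerEdges {V : Type*} [DecidableEq V] {S : Finset V} {u v : V} :
    s(u, v) ∈ innerEdges S ↔ u ∈ S ∧ v ∈ S ∧ u ≠ v := by
  simp only [innerEdges, Finset.mem_image, Finset.mem_offDiag, Prod.exists,
    Function.uncurry_apply_pair]
  constructor
  · rintro ⟨a, b, ⟨ha, hb, hab⟩, h⟩
    rcases Sym2.eq_iff.1 h with ⟨rfl, rfl⟩ | ⟨rfl, rfl⟩
    exacts [⟨ha, hb, hab⟩, ⟨hb, ha, hab.symm⟩]
  · rintro ⟨ha, hb, hab⟩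
    exact ⟨u, v, ⟨ha, hb, hab⟩, rfl⟩

lemma card_innerEdges {V : Type*} [DecidableEq V] (S : Finset V) :
    (innerEdges S).card = S.card.choose 2 :=
  Sym2.card_image_offDiag S

lemma incidentEdges_eq_image {V : Type*} [DecidableEq V] {S : Finset V} {v : V} (hv : v ∈ S) :
    incidentEdges S v = (S.erase v).image fun u => s(v, u) := by
  ext e
  simp only [incidentEdges, Finset.mem_filter, Finset.mem_image, Finset.mem_erase]
  constructor
  · rintro ⟨he, u, rfl⟩
    obtain ⟨-, hu, hne⟩ := mk_mem_innerEdges.1 he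
    exact ⟨u, ⟨hne.symm, hu⟩, rfl⟩
  · rintro ⟨u, ⟨hne, hu⟩, rfl⟩
    exact ⟨mk_mem_innerEdges.2 ⟨hv, hu, hne.symm⟩, Sym2.mem_mk_left v u⟩

lemma card_incidentEdges {V : Type*} [DecidableEq V] {S : Finset V} {v : V} (hv : v ∈ S) :
    (incidentEdges S v).card = S.card - 1 := by
  rw [incidentEdges_eq_image hv, Finset.card_image_of_injective _ (sym2Mk_injective v),
    Finset.card_erase_of_mem hv]

lemma trueCount_incidentEdges {V : Type*} [DecidableEq V] {S : Finset V} {v : V} (hv : v ∈ S)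
    (f : Sym2 V → Bool) :
    trueCount (incidentEdges S v) f =
      {u ∈ (S : Set V) | (SimpleGraph.fromEdgeSet {e | f e = true}).Adj v u}.ncard := by
  classical
  have h : {u ∈ (S : Set V) | (SimpleGraph.fromEdgeSet {e | f e = true}).Adj v u} =
      (({u ∈ S.erase v | f s(v, u) = true} : Finset V) : Set V) := by
    ext u
    simp [SimpleGraph.fromEdgeSet_adj]
    grind
  rw [h, Set.ncard_coe_finset, trueCount, incidentEdges_eq_image hv, Finset.filter_image,
    Finset.card_image_of_injective _ (sym2Mk_injective v)]

lemma isTDependent_fromEdgeSet_iff {V : Type*} [DecidableEq V] (t : ℕ) (S : Finset V)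
    (f : Sym2 V → Bool) :
    IsTDependent (SimpleGraph.fromEdgeSet {e | f e = true}) t (S : Set V) ↔ DegreeLE t S f := by
  refine forall₂_congr fun v hv => ?_
  rw [trueCount_incidentEdges hv]

lemma DegreeLE.two_mul_trueCount_le {V : Type*} [DecidableEq V] {t : ℕ} {S : Finset V}
    {f : Sym2 V → Bool} (h : DegreeLE t S f) :
    2 * trueCount (innerEdges S) f ≤ S.card * t := by
  have hpair : ∀ e ∈ ({e ∈ innerEdges S | f e = true} : Finset (Sym2 V)),
      ({v ∈ S | v ∈ e} : Finset V).card = 2 := by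
    intro e he
    induction e with | _ a b =>
    obtain ⟨ha, hb, hab⟩ := mk_mem_innerEdges.1 (Finset.mem_filter.1 he).1
    rw [← Finset.card_pair hab]
    congr 1
    ext v
    simp only [Finset.mem_filter, Sym2.mem_iff, Finset.mem_insert, Finset.mem_singleton]
    grind
  have hcount := Finset.sum_card_bipartiteAbove_eq_sum_card_bipartiteBelow
    (s := S) (t := ({e ∈ innerEdges S | f e = true} : Finset (Sym2 V))) (fun v e => v ∈ e)
  simp only [Finset.bipartiteAbove, Finset.bipartiteBelow] at hcount
  rw [Finset.sum_congr rfl hpair, Finset.sum_const, smul_eq_mul] at hcount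
  rw [trueCount, mul_comm 2, ← hcount, ← smul_eq_mul S.card t, ← Finset.sum_const]
  refine Finset.sum_le_sum fun v hv => le_of_eq_of_le ?_ (h v hv)
  rw [trueCount, incidentEdges, Finset.filter_filter, Finset.filter_filter]
  simp only [and_comm]

lemma bernoulliWeight_nonneg {E : Type*} [Fintype E] {a : E → ℝ} (h0 : ∀ e, 0 ≤ a e) (h1 : ∀ e, a e ≤ 1)
    (f : E → Bool) : 0 ≤ bernoulliWeight a f := by
  refine Finset.prod_nonneg fun e _ => ?_
  split_ifs
  · exact h0 e
  · exact sub_nonneg.2 (h1 e)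

lemma prod_ite_eq_pow_trueCount {E : Type*} (D : Finset E) (f : E → Bool) (z : ℝ) :
    ∏ e ∈ D, (if f e = true then z else 1) = z ^ trueCount D f := by
  rw [Finset.prod_ite, Finset.prod_const, Finset.prod_const_one, mul_one, trueCount]

/-- The probability generating function of `trueCount D`. -/
lemma sum_bernoulliWeight_mul_pow {E : Type*} [Fintype E] [DecidableEq E] {a : E → ℝ} {D : Finset E} {r : ℝ}
    (ha : ∀ e ∈ D, a e = r) (z : ℝ) :
    ∑ f, bernoulliWeight a f * z ^ trueCount D f = (1 - r + r * z) ^ D.card := by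
  have h : ∀ f : E → Bool, bernoulliWeight a f * z ^ trueCount D f =
      ∏ e, ((if f e = true then a e else 1 - a e) *
        if e ∈ D then (if f e = true then z else 1) else 1) := by
    intro f
    rw [Finset.prod_mul_distrib, Finset.prod_ite_mem, Finset.univ_inter,
      prod_ite_eq_pow_trueCount, bernoulliWeight]
  simp_rw [h]
  rw [← Fintype.prod_sum (fun e b => (if b = true then a e else 1 - a e) *
    if e ∈ D then (if b = true then z else 1) else 1)]
  rw [← Finset.prod_const, ← Finset.univ_inter D, ← Finset.prod_ite_mem]
  refine Finset.prod_congr rfl fun e _ => ?_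
  by_cases he : e ∈ D
  · simp [he, ha e he]; ring
  · simp [he]

lemma sum_bernoulliWeight {E : Type*} [Fintype E] [DecidableEq E] (a : E → ℝ) : ∑ f, bernoulliWeight a f = 1 := by
  simpa [trueCount] using sum_bernoulliWeight_mul_pow (a := a) (D := ∅) (r := 0) (by simp) 1

/-- Changing the bias on `D` from `r` to `p` changes the weight by an explicit factor. -/
lemma bernoulliWeight_change {E : Type*} [Fintype E] [DecidableEq E] {p r : ℝ} (hr0 : 0 < r) (hr1 : r < 1) (hp1 : p < 1)
    (D : Finset E) (f : E → Bool) :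
    bernoulliWeight (fun _ => p) f = bernoulliWeight (fun e => if e ∈ D then r else p) f *
      (((1 - p) / (1 - r)) ^ D.card * (p * (1 - r) / (r * (1 - p))) ^ trueCount D f) := by
  rw [← prod_ite_eq_pow_trueCount, ← Finset.prod_const, ← Finset.prod_mul_distrib,
    ← Finset.univ_inter D, ← Finset.prod_ite_mem, bernoulliWeight, bernoulliWeight,
    ← Finset.prod_mul_distrib]
  have h1 : 1 - r ≠ 0 := by linarith
  have h2 : 1 - p ≠ 0 := by linarith
  refine Finset.prod_congr rfl fun e _ => ?_
  by_cases he : e ∈ D <;> by_cases hf : f e = true <;> simp [he, hf] <;> field_simp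

open Classical in
/-- The probability that `S` is `t`-dependent in `G(n,p)`. -/
noncomputable def dependentProb {V : Type*} [Fintype V] [DecidableEq V] (p : ℝ) (t : ℕ)
    (S : Finset V) : ℝ :=
  ∑ f : Sym2 V → Bool, if DegreeLE t S f then bernoulliWeight (fun _ => p) f else 0

lemma bernoulliBool_singleton {p : ℝ} (b : Bool) :
    bernoulliBool p {b} = ENNReal.ofReal (if b = true then p else 1 - p) := by
  cases b <;> simp [bernoulliBool, ENNReal.ofReal, -Measure.coe_nnreal_smul]

lemma toReal_lintegral_erMeasure {p : ℝ} (hp0 : 0 ≤ p) (hp1 : p ≤ 1) (n t k : ℕ) :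
    (∫⁻ G, (({S : Finset (Fin n) | S.card = k ∧ IsTDependent G t ↑S}.ncard :
      ℕ) : ℝ≥0∞) ∂ erMeasure n p).toReal =
    ∑ S ∈ Finset.powersetCard k (Finset.univ : Finset (Fin n)), dependentProb p t S := by
  classical
  have hmeas : Measurable fun G : SimpleGraph (Fin n) =>
      (({S : Finset (Fin n) | S.card = k ∧ IsTDependent G t ↑S}.ncard : ℕ) : ℝ≥0∞) :=
    measurable_from_top
  rw [erMeasure, lintegral_map hmeas Measurable.of_discrete, lintegral_fintype,
    ENNReal.toReal_sum (fun f _ => ENNReal.mul_ne_top (by simp) (measure_ne_top _ _))]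
  simp only [dependentProb]
  rw [Finset.sum_comm]
  refine Finset.sum_congr rfl fun f _ => ?_
  have hw : ((Measure.pi fun _ : Sym2 (Fin n) => bernoulliBool p) {f}).toReal =
      bernoulliWeight (fun _ => p) f := by
    rw [Measure.pi_singleton, ENNReal.toReal_prod, bernoulliWeight]
    refine Finset.prod_congr rfl fun e _ => ?_
    rw [bernoulliBool_singleton, ENNReal.toReal_ofReal]
    split_ifs <;> linarith
  have hset : {S : Finset (Fin n) | S.card = k ∧
      IsTDependent (SimpleGraph.fromEdgeSet {e | f e = true}) t ↑S} =
      (({S ∈ Finset.powersetCard k Finset.univ | DegreeLE t S f} : Finset (Finset (Fin n))) :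
        Set (Finset (Fin n))) := by
    ext S
    simp [isTDependent_fromEdgeSet_iff]
  rw [ENNReal.toReal_mul, hw, hset, Set.ncard_coe_finset, ENNReal.toReal_natCast,
    ← Finset.sum_filter, Finset.sum_const, nsmul_eq_mul]

lemma trueCount_incidentEdges_le {V : Type*} [DecidableEq V] (S : Finset V) (v : V)
    (f : Sym2 V → Bool) : trueCount (incidentEdges S v) f ≤ trueCount (innerEdges S) f :=
  Finset.card_le_card (Finset.filter_subset_filter _ (Finset.filter_subset _ _))

section dependentProb

variable {V : Type*} [Fintype V] [DecidableEq V] {p : ℝ}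

/-- Chernoff bound for the event that `S` spans at most `#S * t / 2` edges. -/
lemma dependentProb_le (hp0 : 0 ≤ p) (hp1 : p ≤ 1) {y : ℝ} (hy0 : 0 < y) (hy1 : y ≤ 1) (t : ℕ)
    (S : Finset V) :
    dependentProb p t S ≤
      (1 - p + p * y) ^ S.card.choose 2 * y ^ (-((S.card : ℝ) * t / 2)) := by
  classical
  rw [← card_innerEdges, ← sum_bernoulliWeight_mul_pow (a := fun _ => p) (fun _ _ => rfl),
    Finset.sum_mul, dependentProb]
  refine Finset.sum_le_sum fun f _ => ?_
  have hw : 0 ≤ bernoulliWeight (fun _ => p) f :=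
    bernoulliWeight_nonneg (fun _ => hp0) (fun _ => hp1) f
  split_ifs with h
  · have hc : 2 * (trueCount (innerEdges S) f : ℝ) ≤ S.card * t := by
      exact_mod_cast h.two_mul_trueCount_le
    rw [mul_assoc, ← Real.rpow_natCast, ← Real.rpow_add hy0]
    exact le_mul_of_one_le_right hw
      (Real.one_le_rpow_of_pos_of_le_one_of_nonpos hy0 hy1 (by linarith))
  · positivity

/-- `S` is `t`-dependent if it spans no edge. -/
lemma pow_le_dependentProb (hp0 : 0 ≤ p) (hp1 : p ≤ 1) (t : ℕ) (S : Finset V) :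
    (1 - p) ^ S.card.choose 2 ≤ dependentProb p t S := by
  classical
  have h := sum_bernoulliWeight_mul_pow (a := fun _ => p) (D := innerEdges S) (fun _ _ => rfl) 0
  rw [mul_zero, add_zero, card_innerEdges] at h
  rw [← h, dependentProb]
  refine Finset.sum_le_sum fun f _ => ?_
  have hw : 0 ≤ bernoulliWeight (fun _ => p) f :=
    bernoulliWeight_nonneg (fun _ => hp0) (fun _ => hp1) f
  by_cases hc : trueCount (innerEdges S) f = 0
  · have hd : DegreeLE t S f := fun v _ => by
      have := trueCount_incidentEdges_le S v f
      omega
    simp [hc, hd]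
  · rw [zero_pow hc, mul_zero]
    split_ifs
    exacts [hw, le_rfl]

/-- Lower bound by change of measure: in the tilted model with edge probability `r` inside `S`,
`S` is `t`-dependent and spans at least `m` edges unless one of two Chernoff events occurs. -/
lemma le_dependentProb {r z w : ℝ} (hr0 : 0 < r) (hrp : r ≤ p) (hp1 : p < 1) (hz : 1 ≤ z)
    (hw0 : 0 < w) (hw1 : w ≤ 1) (m : ℝ) (t : ℕ) (S : Finset V) :
    ((1 - p) / (1 - r)) ^ S.card.choose 2 * (p * (1 - r) / (r * (1 - p))) ^ m *
      (1 - S.card * ((1 - r + r * z) ^ (S.card - 1) * z ^ (-(t : ℝ))) -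
        (1 - r + r * w) ^ S.card.choose 2 * w ^ (-m)) ≤ dependentProb p t S := by
  classical
  have hz0 : 0 < z := by linarith
  set Y := p * (1 - r) / (r * (1 - p)) with hYdef
  have hY : 1 ≤ Y := by
    rw [hYdef, one_le_div (by nlinarith)]
    nlinarith
  have hY0 : 0 < Y := by linarith
  set c := (1 - p) / (1 - r) with hcdef
  have hc : 0 < c := div_pos (by linarith) (by linarith)
  set a : Sym2 V → ℝ := fun e => if e ∈ innerEdges S then r else p with hadef
  have ha : ∀ e ∈ innerEdges S, a e = r := fun e he => if_pos he
  have hsum : ∑ f, bernoulliWeight a f * (1 - (∑ v ∈ S,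
      z ^ trueCount (incidentEdges S v) f * z ^ (-(t : ℝ))) -
        w ^ trueCount (innerEdges S) f * w ^ (-m)) =
      1 - S.card * ((1 - r + r * z) ^ (S.card - 1) * z ^ (-(t : ℝ))) -
        (1 - r + r * w) ^ S.card.choose 2 * w ^ (-m) := by
    simp_rw [mul_sub, mul_one, Finset.sum_sub_distrib, Finset.mul_sum, ← mul_assoc]
    rw [sum_bernoulliWeight, ← Finset.sum_mul, sum_bernoulliWeight_mul_pow ha, card_innerEdges,
      Finset.sum_comm, Finset.sum_congr rfl fun v hv => by
        rw [← Finset.sum_mul, sum_bernoulliWeight_mul_pow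
          (D := incidentEdges S v) (fun e he => ha e (Finset.mem_filter.1 he).1), card_incidentEdges hv],
      Finset.sum_const, nsmul_eq_mul, mul_assoc]
  rw [← hsum, Finset.mul_sum, dependentProb]
  refine Finset.sum_le_sum fun f _ => ?_
  have hWa : 0 ≤ bernoulliWeight a f := by
    refine bernoulliWeight_nonneg (fun e => ?_) (fun e => ?_) f <;>
      simp only [hadef] <;> split_ifs <;> linarith
  have hb1 : 0 ≤ ∑ v ∈ S, z ^ trueCount (incidentEdges S v) f * z ^ (-(t : ℝ)) := by positivity
  have hb2 : 0 ≤ w ^ trueCount (innerEdges S) f * w ^ (-m) := by positivity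
  have hpos : 0 ≤ c ^ S.card.choose 2 * Y ^ m := by positivity
  have hWp : bernoulliWeight (fun _ => p) f = bernoulliWeight a f *
      (c ^ S.card.choose 2 * Y ^ trueCount (innerEdges S) f) := by
    rw [bernoulliWeight_change hr0 (hrp.trans_lt hp1) hp1 (innerEdges S) f, card_innerEdges]
  rcases le_total (1 - (∑ v ∈ S, z ^ trueCount (incidentEdges S v) f * z ^ (-(t : ℝ))) -
      w ^ trueCount (innerEdges S) f * w ^ (-m)) 0 with hneg | hbr
  · refine (mul_nonpos_of_nonneg_of_nonpos hpos
      (mul_nonpos_of_nonneg_of_nonpos hWa hneg)).trans ?_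
    split_ifs
    · rw [hWp]
      positivity
    · exact le_rfl
  by_cases hd : DegreeLE t S f
  · rw [if_pos hd]
    rcases le_or_gt m (trueCount (innerEdges S) f) with hm | hm
    · rw [hWp, ← Real.rpow_natCast Y]
      calc _ ≤ c ^ S.card.choose 2 * Y ^ m * (bernoulliWeight a f * 1) := by
            gcongr
            linarith
        _ = bernoulliWeight a f * (c ^ S.card.choose 2 * Y ^ m) := by ring
        _ ≤ _ := by gcongr
    · have h1 : 1 ≤ w ^ trueCount (innerEdges S) f * w ^ (-m) := by
        rw [← Real.rpow_natCast, ← Real.rpow_add hw0]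
        exact Real.one_le_rpow_of_pos_of_le_one_of_nonpos hw0 hw1 (by linarith)
      have h0 : 1 - (∑ v ∈ S, z ^ trueCount (incidentEdges S v) f * z ^ (-(t : ℝ))) -
          w ^ trueCount (innerEdges S) f * w ^ (-m) = 0 := by linarith
      rw [h0, mul_zero, mul_zero, hWp]
      positivity
  · rw [if_neg hd]
    simp only [DegreeLE, not_forall, not_le] at hd
    obtain ⟨v, hv, hvt⟩ := hd
    have h1 : 1 ≤ z ^ trueCount (incidentEdges S v) f * z ^ (-(t : ℝ)) := by
      rw [← Real.rpow_natCast, ← Real.rpow_add hz0]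
      refine Real.one_le_rpow hz ?_
      have : (t : ℝ) < trueCount (incidentEdges S v) f := by exact_mod_cast hvt
      linarith
    have h2 := Finset.single_le_sum
      (f := fun v => z ^ trueCount (incidentEdges S v) f * z ^ (-(t : ℝ)))
      (fun u _ => by positivity) hv
    have h0 : 1 - (∑ v ∈ S, z ^ trueCount (incidentEdges S v) f * z ^ (-(t : ℝ))) -
        w ^ trueCount (innerEdges S) f * w ^ (-m) = 0 := by
      linarith
    rw [h0, mul_zero, mul_zero]

end dependentProb

/-- The Chernoff rate at `s` for a Bernoulli variable with parameter `r ≠ s` is positive. -/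
lemma chernoff_base_lt_one {r s : ℝ} (hr : 0 < r) (hs : 0 < s) (hrs : r ≠ s) :
    (1 - r + r * (s / r)) * (s / r) ^ (-s) < 1 := by
  have hz : 0 < s / r := by positivity
  have hinv : r / s ≠ 1 := fun h => hrs (by rwa [div_eq_one_iff_eq hs.ne'] at h)
  have hlog := Real.log_lt_sub_one_of_pos (div_pos hr hs) hinv
  have h1 : s * Real.log (r / s) < r - s := by
    calc s * Real.log (r / s) < s * (r / s - 1) := by gcongr
      _ = r - s := by field_simp
  have h2 : (s / r) ^ (-s) = Real.exp (s * Real.log (r / s)) := by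
    rw [Real.rpow_def_of_pos hz, ← inv_div r s, Real.log_inv]
    ring_nf
  have h3 : 1 - r + r * (s / r) ≤ Real.exp (s - r) := by
    rw [mul_div_cancel₀ _ hr.ne']
    linarith [Real.add_one_le_exp (s - r)]
  calc _ ≤ Real.exp (s - r) * (s / r) ^ (-s) := by gcongr
    _ < 1 := by
      rw [h2, ← Real.exp_add, Real.exp_lt_one_iff]
      linarith

section Rates

variable {p τ κ : ℝ}

/-- The rate given by the Chernoff upper bound is arbitrarily close to the optimal one. -/
lemma exists_chernoff_rate_lt (hp0 : 0 < p) (hp1 : p < 1) (hτ : 0 ≤ τ) (hκ0 : 0 < κ)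
    (hκτ : τ / p < κ) {b : ℝ} (hb : -(κ / 2 * LambdaStar p (τ / κ)) < b) :
    ∃ y, 0 < y ∧ y ≤ 1 ∧ κ / 2 * Real.log (1 - p + p * y) - τ / 2 * Real.log y < b := by
  have hq : 0 < 1 - p := by linarith
  rcases hτ.eq_or_lt with rfl | hτ
  · have hcont : ContinuousAt (fun y => κ / 2 * Real.log (1 - p + p * y)) 0 := by
      refine continuousAt_const.mul (ContinuousAt.log (by fun_prop) ?_)
      simpa using hq.ne'
    have h0 : κ / 2 * Real.log (1 - p + p * 0) < b := by
      simpa [LambdaStar, Real.log_inv] using hb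
    have hev := (hcont.eventually_lt_const h0).filter_mono (nhdsWithin_le_nhds (s := Set.Ioi 0))
    obtain ⟨y, hy, hy0, hy1⟩ := (hev.and (Ioo_mem_nhdsGT (zero_lt_one' ℝ))).exists
    exact ⟨y, hy0, hy1.le, by simpa using hy⟩
  · set x := τ / κ with hx
    have hx0 : 0 < x := by positivity
    have hxp : x < p := by
      rw [hx, div_lt_iff₀ hκ0]
      rwa [div_lt_iff₀ hp0, mul_comm] at hκτ
    have hx1 : 0 < 1 - x := by linarith
    refine ⟨x * (1 - p) / ((1 - x) * p), by positivity, ?_, lt_of_eq_of_lt ?_ hb⟩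
    · rw [div_le_one (by positivity)]
      nlinarith
    · have h1 : 1 - p + p * (x * (1 - p) / ((1 - x) * p)) = (1 - p) / (1 - x) := by
        field_simp
        ring
      have hτx : τ = x * κ := by rw [hx]; field_simp
      rw [h1, hτx, LambdaStar, Real.log_div hq.ne' hx1.ne', Real.log_div (by positivity)
        (by positivity), Real.log_mul hx0.ne' hq.ne', Real.log_mul hx1.ne' hp0.ne',
        Real.log_div hx0.ne' hp0.ne', Real.log_div hx1.ne' hq.ne']
      ring

/-- The rate given by the change of measure is arbitrarily close to the optimal one. -/
lemma exists_tilted_rate_gt {x : ℝ} (hx0 : 0 < x) (hxp : x < p) (hp1 : p < 1) {b : ℝ}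
    (hb : b < -(κ / 2 * LambdaStar p x)) :
    ∃ r' r s, 0 < r' ∧ r' < r ∧ r < s ∧ s < x ∧
      b < κ / 2 * (Real.log ((1 - p) / (1 - r)) +
        r' * Real.log (p * (1 - r) / (r * (1 - p)))) := by
  have hq : 0 < 1 - p := by linarith
  have hp0 : 0 < p := by linarith
  have hx1 : 0 < 1 - x := by linarith
  have hcont : ContinuousAt (fun d => κ / 2 * (Real.log ((1 - p) / (1 - (x - d))) +
      (x - 2 * d) * Real.log (p * (1 - (x - d)) / ((x - d) * (1 - p))))) 0 := by
    have h1 : 1 - (x - 0) ≠ 0 := by rw [sub_zero]; exact hx1.ne'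
    have h2 : (x - 0) * (1 - p) ≠ 0 := by rw [sub_zero]; positivity
    refine continuousAt_const.mul (ContinuousAt.add (ContinuousAt.log ?_ ?_)
      (ContinuousAt.mul (by fun_prop) (ContinuousAt.log ?_ ?_)))
    · exact ContinuousAt.div (by fun_prop) (by fun_prop) h1
    · exact div_ne_zero hq.ne' h1
    · exact ContinuousAt.div (by fun_prop) (by fun_prop) h2
    · exact div_ne_zero (mul_ne_zero hp0.ne' h1) h2
  have h0 : b < κ / 2 * (Real.log ((1 - p) / (1 - (x - 0))) +
      (x - 2 * 0) * Real.log (p * (1 - (x - 0)) / ((x - 0) * (1 - p)))) := by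
    refine lt_of_lt_of_eq hb ?_
    simp only [mul_zero, sub_zero]
    rw [LambdaStar, Real.log_div hq.ne' hx1.ne', Real.log_div (mul_pos hp0 hx1).ne'
        (mul_pos hx0 hq).ne', Real.log_mul hx0.ne' hq.ne', Real.log_mul hp0.ne' hx1.ne',
        Real.log_div hx0.ne' hp0.ne', Real.log_div hx1.ne' hq.ne']
    ring
  have hev := (hcont.eventually_const_lt h0).filter_mono (nhdsWithin_le_nhds (s := Set.Ioi 0))
  obtain ⟨d, hd, hd0, hd1⟩ := (hev.and (Ioo_mem_nhdsGT (half_pos hx0))).exists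
  exact ⟨x - 2 * d, x - d, x - d / 2, by linarith, by linarith, by linarith, by linarith, hd⟩

end Rates

section Asymptotics

variable {κ : ℝ} {k : ℕ → ℕ}

lemma tendsto_log_natCast_atTop : Tendsto (fun n : ℕ => Real.log n) atTop atTop :=
  Real.tendsto_log_atTop.comp tendsto_natCast_atTop_atTop

lemma tendsto_atTop_of_div_log (hκ0 : 0 < κ)
    (hk : Tendsto (fun n => (k n : ℝ) / Real.log n) atTop (nhds κ)) :
    Tendsto k atTop atTop := by
  refine tendsto_natCast_atTop_iff (R := ℝ).1 ?_
  refine (hk.pos_mul_atTop hκ0 tendsto_log_natCast_atTop).congr' ?_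
  filter_upwards [tendsto_log_natCast_atTop.eventually_gt_atTop 0] with n hn
  field_simp

lemma eventually_two_mul_le_of_div_log
    (hk : Tendsto (fun n => (k n : ℝ) / Real.log n) atTop (nhds κ)) :
    ∀ᶠ n in atTop, 2 * k n ≤ n := by
  have h1 : Tendsto (fun n : ℕ => Real.log n / n) atTop (nhds 0) :=
    Real.isLittleO_log_id_atTop.tendsto_div_nhds_zero.comp tendsto_natCast_atTop_atTop
  have h2 := hk.mul h1
  rw [mul_zero] at h2
  filter_upwards [h2.eventually_lt_const (half_pos zero_lt_one),
    tendsto_log_natCast_atTop.eventually_gt_atTop 0, eventually_gt_atTop 0] with n hn hlog hn0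
  have hn0' : (0 : ℝ) < n := by exact_mod_cast hn0
  rw [div_mul_div_cancel₀ hlog.ne', div_lt_iff₀ hn0'] at hn
  have : 2 * (k n : ℝ) ≤ n := by linarith
  exact_mod_cast this

lemma tendsto_choose_two_atTop : Tendsto (fun m : ℕ => m.choose 2) atTop atTop := by
  refine tendsto_atTop_mono (fun m => ?_) (tendsto_sub_atTop_nat 1)
  cases m with
  | zero => simp
  | succ m => simp [Nat.choose_succ_succ' m 1]

lemma tendsto_log_choose_div (hκ0 : 0 < κ)
    (hk : Tendsto (fun n => (k n : ℝ) / Real.log n) atTop (nhds κ)) :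
    Tendsto (fun n => Real.log (n.choose (k n)) / ((k n : ℝ) * Real.log n)) atTop (nhds 1) := by
  have hkt := tendsto_atTop_of_div_log hκ0 hk
  have hlogk : Tendsto (fun n => Real.log (k n) / Real.log n) atTop (nhds 0) := by
    have h1 : Tendsto (fun n => Real.log (k n) / (k n : ℝ)) atTop (nhds 0) :=
      Real.isLittleO_log_id_atTop.tendsto_div_nhds_zero.comp
        (tendsto_natCast_atTop_atTop.comp hkt)
    have h2 := h1.mul hk
    rw [zero_mul] at h2
    refine h2.congr' ?_
    filter_upwards [hkt.eventually_gt_atTop 0] with n hn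
    have : (k n : ℝ) ≠ 0 := by exact_mod_cast hn.ne'
    field_simp
  have hlower : Tendsto (fun n : ℕ => 1 - Real.log 2 / Real.log n - Real.log (k n) / Real.log n)
      atTop (nhds 1) := by
    simpa using (tendsto_const_nhds.sub
      (tendsto_log_natCast_atTop.const_div_atTop (Real.log 2))).sub hlogk
  refine tendsto_of_tendsto_of_tendsto_of_le_of_le' hlower tendsto_const_nhds ?_ ?_
  · filter_upwards [eventually_two_mul_le_of_div_log hk, hkt.eventually_gt_atTop 0,
      tendsto_log_natCast_atTop.eventually_gt_atTop 0] with n h2k hk0 hlog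
    have hk0' : (0 : ℝ) < k n := by exact_mod_cast hk0
    have hn0' : (0 : ℝ) < n := by exact_mod_cast (by omega : 0 < n)
    have hbase : (n : ℝ) / 2 ≤ ((n + 1 - k n : ℕ) : ℝ) := by
      rw [Nat.cast_sub (by omega)]
      have : 2 * (k n : ℝ) ≤ n := by exact_mod_cast h2k
      push_cast
      linarith
    have hfac : ((k n).factorial : ℝ) ≤ (k n : ℝ) ^ k n := by
      exact_mod_cast Nat.factorial_le_pow (k n)
    have hchoose : ((n : ℝ) / 2 / k n) ^ k n ≤ n.choose (k n) := by
      refine le_trans ?_ (Nat.pow_le_choose (α := ℝ) (k n) n)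
      rw [div_pow]
      gcongr
    have h := Real.log_le_log (by positivity) hchoose
    rw [Real.log_pow, Real.log_div (by positivity) hk0'.ne', Real.log_div hn0'.ne' two_ne_zero]
      at h
    rw [le_div_iff₀ (by positivity)]
    refine le_of_eq_of_le ?_ h
    field_simp
  · filter_upwards [eventually_two_mul_le_of_div_log hk, hkt.eventually_gt_atTop 0,
      tendsto_log_natCast_atTop.eventually_gt_atTop 0] with n h2k hk0 hlog
    have hk0' : (0 : ℝ) < k n := by exact_mod_cast hk0
    rw [div_le_one (by positivity), ← Real.log_pow]
    refine Real.log_le_log (by exact_mod_cast Nat.choose_pos (by omega)) ?_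
    exact_mod_cast Nat.choose_le_pow n (k n)

lemma tendsto_choose_two_div (hκ0 : 0 < κ)
    (hk : Tendsto (fun n => (k n : ℝ) / Real.log n) atTop (nhds κ)) :
    Tendsto (fun n => ((k n).choose 2 : ℝ) / ((k n : ℝ) * Real.log n)) atTop (nhds (κ / 2)) := by
  have h : Tendsto (fun n : ℕ => ((k n : ℝ) / Real.log n - 1 / Real.log n) / 2) atTop
      (nhds ((κ - 0) / 2)) :=
    (hk.sub (tendsto_log_natCast_atTop.const_div_atTop 1)).div_const 2
  rw [sub_zero] at h
  refine h.congr' ?_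
  filter_upwards [(tendsto_atTop_of_div_log hκ0 hk).eventually_gt_atTop 0,
    tendsto_log_natCast_atTop.eventually_gt_atTop 0] with n hk0 hlog
  have hk0' : (k n : ℝ) ≠ 0 := by exact_mod_cast hk0.ne'
  rw [Nat.cast_choose_two]
  field_simp

end Asymptotics

/-- The expected number of `t`-dependent `k`-subsets in `G(n,p)`. -/
noncomputable def expectedDependent (p : ℝ) (n t k : ℕ) : ℝ :=
  ∑ S ∈ Finset.powersetCard k (Finset.univ : Finset (Fin n)), dependentProb p t S

lemma expectedDependent_le {p U : ℝ} {n t k : ℕ}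
    (h : ∀ S : Finset (Fin n), S.card = k → dependentProb p t S ≤ U) :
    expectedDependent p n t k ≤ n.choose k * U := by
  refine (Finset.sum_le_card_nsmul _ _ U fun S hS => h S (Finset.mem_powersetCard.1 hS).2).trans ?_
  simp

lemma le_expectedDependent {p L : ℝ} {n t k : ℕ}
    (h : ∀ S : Finset (Fin n), S.card = k → L ≤ dependentProb p t S) :
    n.choose k * L ≤ expectedDependent p n t k := by
  refine le_trans ?_ (Finset.card_nsmul_le_sum _ _ L fun S hS =>
    h S (Finset.mem_powersetCard.1 hS).2)
  simp

lemma expectedDependent_pos {p : ℝ} (hp0 : 0 ≤ p) (hp1 : p < 1) {n k : ℕ} (hkn : k ≤ n) (t : ℕ) :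
    0 < expectedDependent p n t k := by
  have hC : (0 : ℝ) < n.choose k := by exact_mod_cast Nat.choose_pos hkn
  have hq : 0 < 1 - p := by linarith
  refine lt_of_lt_of_le (mul_pos hC (pow_pos hq (k.choose 2))) (le_expectedDependent fun S hS => ?_)
  exact hS ▸ pow_le_dependentProb hp0 hp1.le t S

section Main

variable {p τ κ : ℝ} {t k : ℕ → ℕ}

lemma eventually_log_expectedDependent_lt (hp0 : 0 < p) (hp1 : p < 1) (hτ : 0 ≤ τ) (hκ0 : 0 < κ)
    (hκτ : τ / p < κ)
    (ht : Tendsto (fun n => (t n : ℝ) / Real.log n) atTop (nhds τ))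
    (hk : Tendsto (fun n => (k n : ℝ) / Real.log n) atTop (nhds κ)) {b : ℝ}
    (hb : 1 - κ / 2 * LambdaStar p (τ / κ) < b) :
    ∀ᶠ n in atTop,
      Real.log (expectedDependent p n (t n) (k n)) / ((k n : ℝ) * Real.log n) < b := by
  obtain ⟨y, hy0, hy1, hy⟩ := exists_chernoff_rate_lt hp0 hp1 hτ hκ0 hκτ
    (b := b - 1) (by linarith)
  have hlim := ((tendsto_log_choose_div hκ0 hk).add
    ((tendsto_choose_two_div hκ0 hk).mul_const (Real.log (1 - p + p * y)))).sub
    ((ht.div_const 2).mul_const (Real.log y))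
  filter_upwards [hlim.eventually_lt_const (show _ < b by linarith),
    eventually_two_mul_le_of_div_log hk,
    (tendsto_atTop_of_div_log hκ0 hk).eventually_gt_atTop 0,
    tendsto_log_natCast_atTop.eventually_gt_atTop 0] with n hn h2k hk0 hlog
  have hk0' : (0 : ℝ) < k n := by exact_mod_cast hk0
  have hC : (0 : ℝ) < n.choose (k n) := by exact_mod_cast Nat.choose_pos (by omega)
  have hA : 0 < 1 - p + p * y := by nlinarith
  refine lt_of_le_of_lt ?_ hn
  have hle := Real.log_le_log (expectedDependent_pos hp0.le hp1 (by omega) (t n))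
    (expectedDependent_le (n := n) (k := k n) fun S hS => hS ▸ dependentProb_le hp0.le hp1.le hy0 hy1 (t n) S)
  rw [Real.log_mul hC.ne' (by positivity), Real.log_mul (by positivity) (by positivity),
    Real.log_pow, Real.log_rpow hy0] at hle
  rw [div_le_iff₀ (by positivity)]
  refine hle.trans_eq ?_
  field_simp
  ring

/-- A lower bound for the expectation from a lower bound for the probabilities whose exponent is
`c` per edge, up to a constant factor. -/
lemma eventually_lt_log_expectedDependent (hκ0 : 0 < κ)
    (hk : Tendsto (fun n => (k n : ℝ) / Real.log n) atTop (nhds κ)) {b c : ℝ}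
    (hb : b < 1 + κ / 2 * c)
    (h : ∀ᶠ n in atTop, ∀ S : Finset (Fin n), S.card = k n →
      Real.exp ((k n).choose 2 * c) * 2⁻¹ ≤ dependentProb p (t n) S) :
    ∀ᶠ n in atTop,
      b < Real.log (expectedDependent p n (t n) (k n)) / ((k n : ℝ) * Real.log n) := by
  have hkt := tendsto_atTop_of_div_log hκ0 hk
  have hlim := ((tendsto_log_choose_div hκ0 hk).add
    ((tendsto_choose_two_div hκ0 hk).mul_const c)).sub
    (((tendsto_natCast_atTop_atTop (R := ℝ)).comp hkt).atTop_mul_atTop₀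
      tendsto_log_natCast_atTop |>.const_div_atTop (Real.log 2))
  filter_upwards [hlim.eventually_const_lt (show b < _ by linarith),
    eventually_two_mul_le_of_div_log hk, hkt.eventually_gt_atTop 0,
    tendsto_log_natCast_atTop.eventually_gt_atTop 0, h] with n hn h2k hk0 hlog hS
  have hk0' : (0 : ℝ) < k n := by exact_mod_cast hk0
  have hC : (0 : ℝ) < n.choose (k n) := by exact_mod_cast Nat.choose_pos (by omega)
  refine lt_of_lt_of_le hn ?_
  have hle := Real.log_le_log (by positivity) (le_expectedDependent hS)
  rw [Real.log_mul hC.ne' (by positivity), Real.log_mul (by positivity) (by positivity),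
    Real.log_exp, Real.log_inv] at hle
  rw [le_div_iff₀ (by positivity)]
  refine le_of_eq_of_le ?_ hle
  simp only [Function.comp_apply]
  field_simp
  ring

/-- In the tilted model, `S` is typically `t`-dependent and spans at least
`r' * (#S).choose 2` edges. -/
lemma eventually_le_dependentProb {r' r s : ℝ} (hr' : 0 < r') (hr'r : r' < r) (hrs : r < s)
    (hs : s < τ / κ) (hrp : r ≤ p) (hp1 : p < 1) (hκ0 : 0 < κ)
    (ht : Tendsto (fun n => (t n : ℝ) / Real.log n) atTop (nhds τ))
    (hk : Tendsto (fun n => (k n : ℝ) / Real.log n) atTop (nhds κ)) :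
    ∀ᶠ n in atTop, ∀ S : Finset (Fin n), S.card = k n →
      Real.exp ((k n).choose 2 * (Real.log ((1 - p) / (1 - r)) +
        r' * Real.log (p * (1 - r) / (r * (1 - p))))) * 2⁻¹ ≤ dependentProb p (t n) S := by
  have hr0 : 0 < r := hr'.trans hr'r
  have hs0 : 0 < s := hr0.trans hrs
  have hr1 : r < 1 := hrp.trans_lt hp1
  have hq : 0 < 1 - p := by linarith
  have hq' : 0 < 1 - r := by linarith
  have hp0 : 0 < p := by linarith
  have hkt := tendsto_atTop_of_div_log hκ0 hk
  have hst : ∀ᶠ n in atTop, s * k n ≤ t n := by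
    have h0 := ht.div hk hκ0.ne'
    filter_upwards [h0.eventually_const_lt hs, hkt.eventually_gt_atTop 0,
      tendsto_log_natCast_atTop.eventually_gt_atTop 0] with n hn hk0 hlog
    have hk0' : (0 : ℝ) < k n := by exact_mod_cast hk0
    simp only [Pi.div_apply] at hn
    rw [div_div_div_cancel_right₀ hlog.ne', lt_div_iff₀ hk0'] at hn
    exact hn.le
  have hz1 : 1 ≤ s / r := (one_le_div hr0).2 hrs.le
  have hw1 : r' / r ≤ 1 := (div_le_one hr0).2 hr'r.le
  have hbase : 1 ≤ 1 - r + r * (s / r) := by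
    rw [mul_div_cancel₀ _ hr0.ne']
    linarith
  have hdeg := (tendsto_self_mul_const_pow_of_lt_one (by positivity)
    (chernoff_base_lt_one hr0 hs0 hrs.ne)).comp hkt
  have hedge := (tendsto_pow_atTop_nhds_zero_of_lt_one (by positivity)
    (chernoff_base_lt_one hr0 hr' hr'r.ne')).comp ((tendsto_choose_two_atTop).comp hkt)
  filter_upwards [hst, hdeg.eventually_lt_const (show (0 : ℝ) < 4⁻¹ by norm_num),
    hedge.eventually_lt_const (show (0 : ℝ) < 4⁻¹ by norm_num)] with n hst hdeg hedge S hS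
  refine le_trans ?_ (le_dependentProb hr0 hrp hp1 hz1 (div_pos hr' hr0) hw1
    (r' * (k n).choose 2) (t n) S)
  simp only [Function.comp_apply] at hdeg hedge
  rw [hS]
  have h1 : (k n : ℝ) * ((1 - r + r * (s / r)) ^ (k n - 1) * (s / r) ^ (-(t n : ℝ))) < 4⁻¹ := by
    refine lt_of_le_of_lt ?_ hdeg
    rw [mul_pow, ← Real.rpow_mul_natCast (by positivity)]
    gcongr
    · exact Nat.sub_le _ _
    · linarith
  have h2 : (1 - r + r * (r' / r)) ^ (k n).choose 2 *
      (r' / r) ^ (-(r' * ((k n).choose 2 : ℝ))) < 4⁻¹ := by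
    refine lt_of_eq_of_lt ?_ hedge
    rw [mul_pow, ← Real.rpow_mul_natCast (by positivity), neg_mul]
  have h3 : Real.exp ((k n).choose 2 * (Real.log ((1 - p) / (1 - r)) +
      r' * Real.log (p * (1 - r) / (r * (1 - p))))) = ((1 - p) / (1 - r)) ^ (k n).choose 2 *
      (p * (1 - r) / (r * (1 - p))) ^ (r' * ((k n).choose 2 : ℝ)) := by
    rw [Real.rpow_def_of_pos (by positivity), mul_add, Real.exp_add, Real.exp_nat_mul,
      Real.exp_log (by positivity)]
    ring_nf
  rw [h3]
  gcongr
  linarith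

lemma eventually_lt_log_expectedDependent_of_lt (hp0 : 0 < p) (hp1 : p < 1) (hτ : 0 ≤ τ)
    (hκ0 : 0 < κ) (hκτ : τ / p < κ)
    (ht : Tendsto (fun n => (t n : ℝ) / Real.log n) atTop (nhds τ))
    (hk : Tendsto (fun n => (k n : ℝ) / Real.log n) atTop (nhds κ)) {b : ℝ}
    (hb : b < 1 - κ / 2 * LambdaStar p (τ / κ)) :
    ∀ᶠ n in atTop,
      b < Real.log (expectedDependent p n (t n) (k n)) / ((k n : ℝ) * Real.log n) := by
  have hq : 0 < 1 - p := by linarith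
  rcases hτ.eq_or_lt with rfl | hτ
  · refine eventually_lt_log_expectedDependent hκ0 hk (c := Real.log (1 - p)) ?_
      (Eventually.of_forall fun n S hS => ?_)
    · simpa [LambdaStar, Real.log_inv] using hb
    · rw [Real.exp_nat_mul, Real.exp_log hq, ← hS]
      refine le_trans ?_ (pow_le_dependentProb hp0.le hp1.le (t n) S)
      exact mul_le_of_le_one_right (by positivity) (by norm_num)
  · have hxp : τ / κ < p := by
      rw [div_lt_iff₀ hκ0]
      rwa [div_lt_iff₀ hp0, mul_comm] at hκτ
    obtain ⟨r', r, s, hr', hr'r, hrs, hs, hlt⟩ :=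
      exists_tilted_rate_gt (κ := κ) (div_pos hτ hκ0) hxp hp1 (b := b - 1) (by linarith)
    exact eventually_lt_log_expectedDependent hκ0 hk (by linarith)
      (eventually_le_dependentProb hr' hr'r hrs hs (by linarith) hp1 hκ0 ht hk)

end Main

/-- Fix `0 < p < 1`, `τ ≥ 0` and `κ > 0` with `κ > τ/p`.  If
`t(n)/ln n → τ` and `k(n)/ln n → κ`, then the expected number of t(n)-dependent
k(n)-element vertex subsets of G(n,p) is `exp(k(n)·ln n·(1 - (κ/2)Λ*(τ/κ) + o(1)))`,
i.e. `ln E(|S|)/(k(n)·ln n) → 1 - (κ/2)·Λ*(τ/κ)`. -/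
theorem stmt11 (p : ℝ) (hp0 : 0 < p) (hp1 : p < 1) (τ κ : ℝ) (hτ : 0 ≤ τ) (hκ0 : 0 < κ)
    (hκτ : τ / p < κ) (t k : ℕ → ℕ) (hkpos : ∀ n, 0 < k n)
    (ht : Tendsto (fun n => (t n : ℝ) / Real.log n) atTop (nhds τ))
    (hk : Tendsto (fun n => (k n : ℝ) / Real.log n) atTop (nhds κ)) :
    Tendsto (fun n =>
        Real.log (∫⁻ G, (({S : Finset (Fin n) | S.card = k n ∧ IsTDependent G (t n) ↑S}.ncard :
              ℕ) : ℝ≥0∞) ∂ erMeasure n p).toReal / ((k n : ℝ) * Real.log n))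
      atTop (nhds (1 - κ / 2 * LambdaStar p (τ / κ))) := by
  simp_rw [toReal_lintegral_erMeasure hp0.le hp1.le]
  exact tendsto_order.2
    ⟨fun _ hb => eventually_lt_log_expectedDependent_of_lt hp0 hp1 hτ hκ0 hκτ ht hk hb,
      fun _ hb => eventually_log_expectedDependent_lt hp0 hp1 hτ hκ0 hκτ ht hk hb⟩
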